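/- For all integers n ≥ 0 and k ≥ 0, and every integer α > 2k+1, the number of (2^α, 3)-biregular overpartitions of 4^k·(4n+3) is divisible by 3, i.e. B̄_{2^α,3}(4^k(4n+3)) ≡ 0 (mod 3). -/

import Mathlib

/-- The number of `(ℓ₁, ℓ₂)`-biregular overpartitions of `n`: an overpartition is a pair
`(s, t)` of multisets of positive parts, where `t` (the multiset of overlined parts) has
distinct parts, and the sizes sum to `n`; here additionally no part may be divisible by
`ℓ₁` or by `ℓ₂`. -/
noncomputable def biregularOverpartitions (ℓ₁ ℓ₂ n : ℕ) : ℕ :=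
  Set.ncard {p : Multiset ℕ × Multiset ℕ |
    (∀ x ∈ p.1, 0 < x ∧ ¬ ℓ₁ ∣ x ∧ ¬ ℓ₂ ∣ x) ∧
    (∀ x ∈ p.2, 0 < x ∧ ¬ ℓ₁ ∣ x ∧ ¬ ℓ₂ ∣ x) ∧
    p.2.Nodup ∧ p.1.sum + p.2.sum = n}
open PowerSeries Finset

section gauss
variable {R : Type*} [CommRing R]

theorem shanks_partial (q : R) (n k : ℕ) (hk : k ≤ n) :
    (∏ m ∈ Ico 1 (n+2), (1 - q^m)) +
      ∑ s ∈ range k, 2 * (-1)^(s+1) * q^((s+1)*(n+2)) * (∏ m ∈ Ico 1 (s+1), (1 + q^m)) *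
        (∏ m ∈ Ico (s+2) (n+2), (1 - q^m))
    - (1 + q^(n+1)) * ((∏ m ∈ Ico 1 (n+1), (1 - q^m)) +
      ∑ s ∈ range k, 2 * (-1)^(s+1) * q^((s+1)*(n+1)) * (∏ m ∈ Ico 1 (s+1), (1 + q^m)) *
        (∏ m ∈ Ico (s+2) (n+1), (1 - q^m)))
    = - (2 * (-1)^k * q^((k+1)*(n+1)) * (∏ m ∈ Ico 1 (k+1), (1 + q^m)) *
        (∏ m ∈ Ico (k+1) (n+1), (1 - q^m))) := by
  induction k with
  | zero =>
    rw [Finset.prod_Ico_succ_top (by omega : 1 ≤ n+1)]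
    simp
    ring
  | succ k ih =>
    have ih := ih (by omega)
    rw [Finset.sum_range_succ, Finset.sum_range_succ]
    rw [Finset.prod_eq_prod_Ico_succ_bot (by omega : k+1 < n+1)] at ih
    rw [Finset.prod_Ico_succ_top (by omega : k+2 ≤ n+1),
      Finset.prod_Ico_succ_top (by omega : 1 ≤ k+1)]
    simp only [show k+1+1 = k+2 from rfl] at *
    linear_combination ih

theorem shanks (q : R) (n : ℕ) :
    (∏ m ∈ Ico 1 (n+1), (1 + q^m)) * (1 + ∑ s ∈ range n, 2 * (-1)^(s+1) * q^((s+1)^2))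
    = (∏ m ∈ Ico 1 (n+1), (1 - q^m)) +
      ∑ s ∈ range n, 2 * (-1)^(s+1) * q^((s+1)*(n+1)) * (∏ m ∈ Ico 1 (s+1), (1 + q^m)) *
        (∏ m ∈ Ico (s+2) (n+1), (1 - q^m)) := by
  induction n with
  | zero => simp
  | succ n ih =>
    have h := shanks_partial q n n le_rfl
    simp only [show n+1+1 = n+2 from rfl] at *
    rw [Finset.sum_range_succ, Finset.sum_range_succ]
    have e : (∏ m ∈ Ico 1 (n+2), (1 + q^m)) = (∏ m ∈ Ico 1 (n+1), (1 + q^m)) * (1 + q^(n+1)) :=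
      Finset.prod_Ico_succ_top (by omega) _
    simp only [Finset.Ico_self, Finset.prod_empty] at *
    rw [e]
    linear_combination (1 + q^(n+1)) * ih - h

theorem gauss_trunc (n : ℕ) : ∃ r : R⟦X⟧, 
    (∏ m ∈ Ico 1 (n+1), (1 + (X:R⟦X⟧)^m)) * (1 + ∑ s ∈ range n, 2 * (-1)^(s+1) * X^((s+1)^2))
    = (∏ m ∈ Ico 1 (n+1), (1 - X^m)) + X^(n+1) * r := by
  rw [shanks]
  obtain ⟨r, hr⟩ : (X:R⟦X⟧)^(n+1) ∣ ∑ s ∈ range n, 2 * (-1)^(s+1) * X^((s+1)*(n+1)) * (∏ m ∈ Ico 1 (s+1), (1 + X^m)) *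
        (∏ m ∈ Ico (s+2) (n+1), (1 - X^m)) := by
    apply Finset.dvd_sum
    intro s _
    refine Dvd.dvd.mul_right (Dvd.dvd.mul_right (Dvd.dvd.mul_left (pow_dvd_pow _ ?_) _) _) _
    nlinarith
  exact ⟨r, by rw [hr]⟩

end gauss

theorem not_two_sq (k : ℕ) : ∀ n a b : ℕ, a^2 + b^2 ≠ 4^k * (4*n+3) := by
  induction k with
  | zero =>
    intro n a b h
    have := congrArg (· % 4) h
    simp [Nat.add_mod, Nat.pow_mod] at this
    have ha : a % 4 < 4 := Nat.mod_lt _ (by norm_num)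
    have hb : b % 4 < 4 := Nat.mod_lt _ (by norm_num)
    interval_cases a % 4 <;> interval_cases b % 4 <;> simp at this
  | succ k ih =>
    intro n a b h
    have h0 : (a^2+b^2) % 4 = 0 := by rw [h, pow_succ, mul_comm (4^k) 4, mul_assoc, Nat.mul_mod_right]
    have : a % 2 = 0 ∧ b % 2 = 0 := by
      have ha : a % 4 < 4 := Nat.mod_lt _ (by norm_num)
      have hb : b % 4 < 4 := Nat.mod_lt _ (by norm_num)
      rw [← Nat.mod_mod_of_dvd a (by norm_num : 2 ∣ 4), ← Nat.mod_mod_of_dvd b (by norm_num : 2 ∣ 4)]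
      simp [Nat.add_mod, Nat.pow_mod] at h0
      interval_cases a % 4 <;> interval_cases b % 4 <;> simp at h0 ⊢
    obtain ⟨a', rfl⟩ := Nat.dvd_of_mod_eq_zero this.1
    obtain ⟨b', rfl⟩ := Nat.dvd_of_mod_eq_zero this.2
    apply ih n a' b'
    rw [pow_succ 4 k] at h
    nlinarith

noncomputable def gS (m : ℕ) : (ZMod 3)⟦X⟧ := PowerSeries.mk fun n => if m ∣ n then 1 else 0
noncomputable def hS (m : ℕ) : (ZMod 3)⟦X⟧ := PowerSeries.mk fun n => if m ∣ n then (-1)^(n/m) else 0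

theorem gS_mul (m : ℕ) (hm : 0 < m) : (1 - X^m) * gS m = 1 := by
  ext n
  rw [sub_mul, one_mul, map_sub, PowerSeries.coeff_X_pow_mul', PowerSeries.coeff_one]
  simp only [gS, coeff_mk]
  by_cases h : m ≤ n
  · obtain ⟨c, rfl⟩ := Nat.exists_eq_add_of_le h
    have : m + c ≠ 0 := by omega
    simp [hm.ne']
  · by_cases h0 : n = 0
    · simp [h0, hm.ne']
    · have : ¬ m ∣ n := fun hd => h (Nat.le_of_dvd (by omega) hd)
      simp [h, h0, this]

theorem hS_mul (m : ℕ) (hm : 0 < m) : (1 + X^m) * hS m = 1 := by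
  ext n
  rw [add_mul, one_mul, map_add, PowerSeries.coeff_X_pow_mul', PowerSeries.coeff_one]
  simp only [hS, coeff_mk]
  by_cases h : m ≤ n
  · obtain ⟨c, rfl⟩ := Nat.exists_eq_add_of_le h
    have : m + c ≠ 0 := by omega
    by_cases hc : m ∣ c
    · simp [hm.ne', hc, Nat.add_div_left, hm, pow_succ]
    · simp [hm.ne', hc]
  · by_cases h0 : n = 0
    · simp [h0, hm.ne']
    · have : ¬ m ∣ n := fun hd => h (Nat.le_of_dvd (by omega) hd)
      simp [h, h0, this]

/-- supported on multiples of `L` -/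
def Supp (L : ℕ) (f : (ZMod 3)⟦X⟧) : Prop := ∀ n, ¬ L ∣ n → coeff n f = 0

theorem Supp.mul {L : ℕ} {f g : (ZMod 3)⟦X⟧} (hf : Supp L f) (hg : Supp L g) : Supp L (f * g) := by
  intro n hn
  rw [coeff_mul]
  apply Finset.sum_eq_zero
  rintro ⟨a, b⟩ hab
  rw [HasAntidiagonal.mem_antidiagonal] at hab
  simp only at hab ⊢
  by_cases ha : L ∣ a
  · have hb : ¬ L ∣ b := fun hb => hn (hab ▸ dvd_add ha hb)
    rw [hg b hb, mul_zero]
  · rw [hf a ha, zero_mul]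

theorem Supp.prod {L : ℕ} (s : Finset ℕ) (f : ℕ → (ZMod 3)⟦X⟧) (h : ∀ i ∈ s, Supp L (f i)) :
    Supp L (∏ i ∈ s, f i) := by
  apply Finset.prod_induction _ _ (fun _ _ => Supp.mul) _ h
  intro n hn
  rw [coeff_one, if_neg]
  rintro rfl
  simp at hn

theorem Supp.hS {L m : ℕ} (h : L ∣ m) : Supp L (hS m) := by
  intro n hn
  simp only [_root_.hS, coeff_mk]
  rw [if_neg (fun hd => hn (h.trans hd))]

theorem Supp.one_sub {L m : ℕ} (h : L ∣ m) : Supp L (1 - X^m) := by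
  intro n hn
  rw [map_sub, coeff_one, coeff_X_pow, if_neg, if_neg, sub_zero]
  · rintro rfl; exact hn h
  · rintro rfl; simp at hn

/-- the main product -/
theorem W_coeff (N k n : ℕ) (hN : 4^k * (4*n+3) ≤ N) :
    coeff (4^k * (4*n+3)) (∏ m ∈ (Ico 1 (3*N+1)).filter (fun m => ¬ 3 ∣ m), ((1 + X^m) * gS m)) = 0 := by
  set W := (∏ m ∈ (Ico 1 (3*N+1)).filter (fun m => ¬ 3 ∣ m), ((1 + X^m) * gS m)) with hW
  have hg : ∀ M, (∏ m ∈ Ico 1 (M+1), (1 - X^m)) * (∏ m ∈ Ico 1 (M+1), gS m) = 1 := by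
    intro M
    rw [← Finset.prod_mul_distrib]
    apply Finset.prod_eq_one
    intro m hm
    rw [mem_Ico] at hm
    exact gS_mul m (by omega)
  set F : ℕ → (ZMod 3)⟦X⟧ := fun M => ∏ m ∈ Ico 1 (M+1), ((1 + X^m) * gS m) with hF
  set θ : ℕ → (ZMod 3)⟦X⟧ := fun M => (1 + ∑ s ∈ range M, 2 * (-1)^(s+1) * X^((s+1)^2)) with hθ
  have hFθ : ∀ M, ∃ r, F M * θ M = 1 + X^(M+1) * r := by
    intro M
    obtain ⟨r, hr⟩ := gauss_trunc (R := ZMod 3) M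
    refine ⟨r * (∏ m ∈ Ico 1 (M+1), gS m), ?_⟩
    simp only [hF, hθ, Finset.prod_mul_distrib]
    linear_combination (∏ m ∈ Ico 1 (M+1), gS m) * hr + hg M
  have hθ3 : ∃ r, θ (3*N) = θ N + X^(N+1) * r := by
    obtain ⟨r, hr⟩ : (X:(ZMod 3)⟦X⟧)^(N+1) ∣ ∑ s ∈ Ico N (3*N), 2 * (-1)^(s+1) * X^((s+1)^2) := by
      apply Finset.dvd_sum
      intro s hs
      rw [mem_Ico] at hs
      refine Dvd.dvd.mul_left (pow_dvd_pow _ ?_) _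
      nlinarith
    refine ⟨r, ?_⟩
    simp only [hθ]
    rw [← hr, add_assoc, Finset.sum_range_add_sum_Ico _ (by omega)]
  have h3 : (3 : (ZMod 3)⟦X⟧) = 0 := by
    have : ((3:ℕ) : (ZMod 3)⟦X⟧) = 0 := by
      rw [← map_natCast (PowerSeries.C (R := ZMod 3))]
      have : ((3:ℕ) : ZMod 3) = 0 := by decide
      rw [this, map_zero]
    exact_mod_cast this
  have hcube : ∀ m, 0 < m → (1 + X^(3*m)) * gS (3*m) = ((1 + X^m) * gS m)^3 := by
    intro m hm
    have h1 := gS_mul m hm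
    have h2 := gS_mul (3*m) (by omega)
    have e1 : (1 + (X:(ZMod 3)⟦X⟧)^(3*m)) = (1 + X^m)^3 := by
      rw [mul_comm 3 m, pow_mul]
      linear_combination (-(X^m) - (X^m)^2) * h3
    have e2 : (1 - (X:(ZMod 3)⟦X⟧)^(3*m)) = (1 - X^m)^3 := by
      rw [mul_comm 3 m, pow_mul]
      linear_combination ((X^m) - (X^m)^2) * h3
    have e3 : gS (3*m) = (gS m)^3 := by
      rw [e2] at h2
      have h1' : (1 - (X:(ZMod 3)⟦X⟧)^m)^3 * (gS m)^3 = 1 := by rw [← mul_pow, h1, one_pow]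
      linear_combination (gS m)^3 * h2 - gS (3*m) * h1'
    rw [e1, e3, mul_pow]
  have hWF : W * (F N)^3 = F (3*N) := by
    simp only [hF, hW]
    rw [← Finset.prod_pow, ← Finset.prod_filter_not_mul_prod_filter (Ico 1 (3*N+1)) (fun m => 3 ∣ m)]
    congr 1
    rw [Finset.prod_congr rfl (g := fun m => (1 + X^(3*m)) * gS (3*m))
      (fun m hm => (hcube m (by rw [mem_Ico] at hm; omega)).symm)]
    refine Finset.prod_nbij' (fun m => 3*m) (fun m => m/3) ?_ ?_ ?_ ?_ ?_
    · intro m; simp only [mem_Ico, mem_filter]; omega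
    · intro m; simp only [mem_Ico, mem_filter]; omega
    · intro m; simp only [mem_Ico]; omega
    · intro m; simp only [mem_Ico, mem_filter]; omega
    · intro m _; rfl
  obtain ⟨r, hr⟩ := hFθ N
  obtain ⟨s, hs⟩ := hFθ (3*N)
  obtain ⟨t, ht⟩ := hθ3
  have hs' : F (3*N) * θ N = 1 + X^(N+1) * (X^(2*N) * s - F (3*N) * t) := by
    rw [ht] at hs
    have : (X:(ZMod 3)⟦X⟧)^(3*N+1) = X^(N+1) * X^(2*N) := by rw [← pow_add]; congr 1; omega
    rw [this] at hs
    linear_combination hs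
  set s' := (X^(2*N) * s - F (3*N) * t)
  have key : W = (θ N)^2 + X^(N+1) * ((θ N)^2 * s' - W * (3*r + 3 * X^(N+1)*r^2 + (X^(N+1))^2*r^3)) := by
    have h1 : W * (1 + X^(N+1) * r)^3 = (θ N)^2 * (1 + X^(N+1)*s') := by
      rw [← hr, ← hs', ← hWF]; ring
    linear_combination h1
  rw [key, map_add, coeff_X_pow_mul', if_neg (by omega), add_zero, pow_two, coeff_mul]
  have hsq : ∀ a, coeff a (θ N) ≠ 0 → ∃ c, a = c^2 := by
    intro a ha
    by_contra hc
    push Not at hc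
    apply ha
    simp only [hθ]
    rw [map_add, coeff_one, if_neg (by simpa using hc 0), zero_add, map_sum]
    apply Finset.sum_eq_zero
    intro i _
    rw [coeff_mul_X_pow', ]
    split_ifs with h
    · have : (2 * (-1)^(i+1) : (ZMod 3)⟦X⟧) = C (2 * (-1)^(i+1)) := by
        rw [map_mul, map_pow, map_neg, map_one, map_ofNat]
      rw [this, coeff_C, if_neg]
      have := hc (i+1)
      omega
    · rfl
  apply Finset.sum_eq_zero
  rintro ⟨a, b⟩ hab
  rw [HasAntidiagonal.mem_antidiagonal] at hab
  by_contra hne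
  obtain ⟨c, hc⟩ := hsq a (left_ne_zero_of_mul hne)
  obtain ⟨d, hd⟩ := hsq b (right_ne_zero_of_mul hne)
  simp only at hab
  rw [hc, hd] at hab
  exact not_two_sq k n c d hab

theorem coeff_prod_gS (S : Finset ℕ) (hS : ∀ m ∈ S, 0 < m) (a : ℕ) :
    coeff a (∏ m ∈ S, gS m) = ((Nat.Partition.restricted a (· ∈ S)).card : ZMod 3) := by
  let _ : TopologicalSpace (ZMod 3) := ⊥
  have _ : DiscreteTopology (ZMod 3) := ⟨rfl⟩
  open PowerSeries.WithPiTopology in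
  have h := Nat.Partition.powerSeriesMk_card_restricted_eq_tprod (ZMod 3) (· ∈ S)
  have hg : ∀ i, (∑' j : ℕ, (X:(ZMod 3)⟦X⟧) ^ ((i + 1) * j)) = gS (i+1) := by
    intro i
    have h1 := gS_mul (i+1) (by omega)
    have h2 := PowerSeries.WithPiTopology.tsum_pow_mul_one_sub_of_constantCoeff_eq_zero
      (f := (X:(ZMod 3)⟦X⟧)^(i+1)) (by simp)
    simp_rw [pow_mul]
    linear_combination gS (i+1) * h2 - (∑' j : ℕ, ((X:(ZMod 3)⟦X⟧) ^ (i + 1))^ j) * h1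
  simp_rw [hg] at h
  have h3 : ∏' i, (if i + 1 ∈ S then gS (i+1) else 1) = ∏ m ∈ S, gS m := by
    have hinj : Set.InjOn (fun m => m - 1) (S : Set ℕ) := by
      intro x hx y hy hxy
      have := hS x hx
      have := hS y hy
      simp only at hxy
      omega
    rw [tprod_eq_prod (s := S.image (fun m => m - 1))]
    · rw [Finset.prod_image hinj]
      apply Finset.prod_congr rfl
      intro m hm
      have := hS m hm
      rw [Nat.sub_add_cancel this, if_pos hm]
    · intro b hb
      rw [if_neg]
      intro hb'
      exact hb (mem_image.2 ⟨b+1, hb', rfl⟩)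
  rw [h3] at h
  rw [← h, coeff_mk]

theorem coeff_prod_one_add (S : Finset ℕ) (b : ℕ) :
    coeff b (∏ m ∈ S, (1 + (X:(ZMod 3)⟦X⟧)^m)) =
      ((S.powerset.filter (fun T => ∑ x ∈ T, x = b)).card : ZMod 3) := by
  rw [Finset.prod_one_add, map_sum, Finset.card_filter]
  push_cast
  apply Finset.sum_congr rfl
  intro T _
  rw [Finset.prod_pow_eq_pow_sum, coeff_X_pow]
  simp [eq_comm]

theorem count_eq (L N M : ℕ) (hM : N ≤ M) :
    (biregularOverpartitions L 3 N : ZMod 3) =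
    coeff N (∏ m ∈ (Ico 1 (M+1)).filter (fun m => ¬ L ∣ m ∧ ¬ 3 ∣ m), ((1 + X^m) * gS m)) := by
  classical
  set S := (Ico 1 (M+1)).filter (fun m => ¬ L ∣ m ∧ ¬ 3 ∣ m) with hSdef
  have hS : ∀ m ∈ S, 0 < m := by
    intro m hm
    rw [hSdef, mem_filter, mem_Ico] at hm
    omega
  have hmem : ∀ x, x ≤ N → (x ∈ S ↔ 0 < x ∧ ¬ L ∣ x ∧ ¬ 3 ∣ x) := by
    intro x hx
    rw [hSdef, mem_filter, mem_Ico]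
    constructor
    · rintro ⟨h1, h2⟩; exact ⟨by omega, h2⟩
    · rintro ⟨h1, h2⟩; exact ⟨by omega, h2⟩
  set U : ℕ → Finset (Multiset ℕ) := fun a =>
    (Nat.Partition.restricted a (· ∈ S)).image Nat.Partition.parts with hU
  set V : ℕ → Finset (Multiset ℕ) := fun b =>
    (S.powerset.filter (fun T => ∑ x ∈ T, x = b)).image Finset.val with hV
  have hUmem : ∀ a s, s ∈ U a ↔ (∀ x ∈ s, x ∈ S) ∧ s.sum = a := by
    intro a s
    simp only [hU, mem_image, Nat.Partition.restricted, mem_filter, mem_univ, true_and]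
    constructor
    · rintro ⟨p, hp, rfl⟩
      exact ⟨hp, p.parts_sum⟩
    · rintro ⟨h1, h2⟩
      exact ⟨⟨s, fun {i} hi => hS i (h1 i hi), h2⟩, h1, rfl⟩
  have hVmem : ∀ b t, t ∈ V b ↔ (∀ x ∈ t, x ∈ S) ∧ t.Nodup ∧ t.sum = b := by
    intro b t
    simp only [hV, mem_image, mem_filter, mem_powerset]
    constructor
    · rintro ⟨T, ⟨h1, h2⟩, rfl⟩
      refine ⟨fun x hx => h1 hx, T.nodup, ?_⟩
      rw [← h2]
      simp only [Finset.sum, Multiset.map_id']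
    · rintro ⟨h1, h2, h3⟩
      refine ⟨⟨t, h2⟩, ⟨fun x hx => h1 x hx, ?_⟩, rfl⟩
      rw [← h3]
      simp only [Finset.sum, Multiset.map_id']
  have hUc : ∀ a, (U a).card = (Nat.Partition.restricted a (· ∈ S)).card := by
    intro a
    apply Finset.card_image_of_injective
    intro p q h
    exact Nat.Partition.ext h
  have hVc : ∀ b, (V b).card = (S.powerset.filter (fun T => ∑ x ∈ T, x = b)).card := by
    intro b
    apply Finset.card_image_of_injective
    exact Finset.val_injective
  have hset : {p : Multiset ℕ × Multiset ℕ |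
      (∀ x ∈ p.1, 0 < x ∧ ¬ L ∣ x ∧ ¬ 3 ∣ x) ∧
      (∀ x ∈ p.2, 0 < x ∧ ¬ L ∣ x ∧ ¬ 3 ∣ x) ∧
      p.2.Nodup ∧ p.1.sum + p.2.sum = N} =
      ((HasAntidiagonal.antidiagonal N).biUnion (fun ab => U ab.1 ×ˢ V ab.2) : Finset _) := by
    ext ⟨s, t⟩
    simp only [Set.mem_ofPred_eq, coe_biUnion, Set.mem_iUnion, mem_coe, mem_product, hUmem, hVmem,
      HasAntidiagonal.mem_antidiagonal]
    constructor
    · rintro ⟨h1, h2, h3, h4⟩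
      refine ⟨(s.sum, t.sum), h4, ⟨fun x hx => ?_, rfl⟩, fun x hx => ?_, h3, rfl⟩
      · have := Multiset.le_sum_of_mem hx
        exact (hmem x (by omega)).2 (h1 x hx)
      · have := Multiset.le_sum_of_mem hx
        exact (hmem x (by omega)).2 (h2 x hx)
    · rintro ⟨⟨a, b⟩, hab, ⟨h1, h2⟩, h3, h4, h5⟩
      simp only at hab h2 h5
      refine ⟨fun x hx => ?_, fun x hx => ?_, h4, by omega⟩
      · have := Multiset.le_sum_of_mem hx
        exact (hmem x (by omega)).1 (h1 x hx)
      · have := Multiset.le_sum_of_mem hx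
        exact (hmem x (by omega)).1 (h3 x hx)
  rw [biregularOverpartitions, hset, Set.ncard_coe_finset, Finset.card_biUnion]
  · rw [Finset.prod_mul_distrib, mul_comm, coeff_mul]
    push_cast
    apply Finset.sum_congr rfl
    rintro ⟨a, b⟩ _
    rw [coeff_prod_gS S hS, coeff_prod_one_add, Finset.card_product, hUc, hVc]
    push_cast
    rfl
  · rintro ⟨a, b⟩ _ ⟨c, d⟩ _ hne
    rw [Function.onFun, Finset.disjoint_left]
    rintro ⟨s, t⟩ h1 h2
    simp only [mem_product, hUmem, hVmem] at h1 h2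
    apply hne
    rw [Prod.mk.injEq]
    exact ⟨h1.1.2.symm.trans h2.1.2, h1.2.2.2.symm.trans h2.2.2.2⟩

theorem biregular_overpartition_pow2_3_4k4n3_mod3 (n k α : ℕ) (hα : 2 * k + 1 < α) :
    3 ∣ biregularOverpartitions (2 ^ α) 3 (4 ^ k * (4 * n + 3)) := by
  rw [← ZMod.natCast_eq_zero_iff]
  set N := 4 ^ k * (4 * n + 3) with hN
  set L := 2 ^ α with hL
  have hLd : 4^(k+1) ∣ L := by
    rw [hL, show (4:ℕ) = 2^2 from rfl, ← pow_mul]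
    exact pow_dvd_pow _ (by omega)
  rw [count_eq L N (3*N) (by omega)]
  set D := ∏ m ∈ ((Ico 1 (3*N+1)).filter (fun m => ¬ 3 ∣ m)).filter (fun m => L ∣ m),
    ((1 - X^m) * hS m) with hD
  have hDs : Supp L D := by
    apply Supp.prod
    intro m hm
    rw [mem_filter] at hm
    exact (Supp.one_sub hm.2).mul (Supp.hS hm.2)
  have hG : (∏ m ∈ (Ico 1 (3*N+1)).filter (fun m => ¬ L ∣ m ∧ ¬ 3 ∣ m), ((1 + X^m) * gS m)) =
      (∏ m ∈ (Ico 1 (3*N+1)).filter (fun m => ¬ 3 ∣ m), ((1 + X^m) * gS m)) * D := by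
    rw [← Finset.prod_filter_not_mul_prod_filter ((Ico 1 (3*N+1)).filter (fun m => ¬ 3 ∣ m))
      (fun m => L ∣ m), mul_assoc, hD, ← Finset.prod_mul_distrib, Finset.filter_filter]
    rw [Finset.prod_eq_one (s := filter (fun m => L ∣ m) _), mul_one]
    · apply Finset.prod_congr _ (fun _ _ => rfl)
      ext m
      simp only [mem_filter]
      tauto
    · intro m hm
      rw [mem_filter, mem_filter, mem_Ico] at hm
      have h1 := gS_mul m (by omega)
      have h2 := hS_mul m (by omega)
      linear_combination (1 + X^m) * hS m * h1 + h2
  rw [hG, coeff_mul]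
  apply Finset.sum_eq_zero
  rintro ⟨a, b⟩ hab
  rw [HasAntidiagonal.mem_antidiagonal] at hab
  simp only at hab ⊢
  by_cases hb : L ∣ b
  · obtain ⟨c, hc⟩ := hLd.trans hb
    have h4 : 0 < 4^k := by positivity
    have hcn : c ≤ n := by
      by_contra hcc
      have h5 : n + 1 ≤ c := by omega
      have : 4^(k+1) * (n+1) ≤ b := by rw [hc]; exact Nat.mul_le_mul_left _ h5
      rw [pow_succ] at this
      nlinarith
    obtain ⟨d, rfl⟩ := Nat.exists_eq_add_of_le hcn
    have ha : a = 4^k * (4*d+3) := by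
      rw [hN, hc, pow_succ] at hab
      nlinarith
    rw [ha, W_coeff N k d (by rw [← ha]; omega), zero_mul]
  · rw [hDs b hb, mul_zero]
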